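/- Let (S,T) be a valid pair of spanning 2-matchings of G such that S contains a cycle. Then there exist four path covers S1, S2, T1, T2 of G satisfying, for i = 1,2: S_i ∪ T_i = S ∪ T and S_i ∩ T_i = S ∩ T; V1(S_i) ∪ V1(T_i) = V1(S) ∪ V1(T) and V1(S_i) ∩ V1(T_i) = V1(S) ∩ V1(T); and there exist edges e1, e2 ∈ E and a path P ∈ 𝒫(T1 ∩ T2) such that T1 \ T2 = {e1}, T2 \ T1 = {e2}, and both P ∪ {e1} ⊆ T1 and P ∪ {e2} ⊆ T2 are paths. Moreover, if S is in addition a 2-factor of G, then V1(S_i) and V1(T_i) form a partition of V1(T) for i = 1,2, i.e. V1(S_i) ∪ V1(T_i) = V1(T) and V1(S_i) ∩ V1(T_i) = ∅. -/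

import Mathlib

variable {V : Type*} [Fintype V] [DecidableEq V]

/-- The degree of vertex `v` in the edge set `F`. -/
def degE (F : Finset (Sym2 V)) (v : V) : ℕ := (F.filter (fun e => v ∈ e)).card

/-- The set of vertices incident to an edge of `F`. -/
def VsetE (F : Finset (Sym2 V)) : Set V := {v | ∃ e ∈ F, v ∈ e}

/-- Vertices incident to exactly one edge of `F`. -/
def V1E (F : Finset (Sym2 V)) : Set V := {v | degE F v = 1}

/-- Vertices incident to exactly two edges of `F`. -/
def V2E (F : Finset (Sym2 V)) : Set V := {v | degE F v = 2}

/-- All edges are genuine edges of the complete graph (no loops). -/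
def SimpleE (F : Finset (Sym2 V)) : Prop := ∀ e ∈ F, ¬ e.IsDiag

/-- `F` is spanning: every vertex is incident to an edge of `F`. -/
def SpanningE (F : Finset (Sym2 V)) : Prop := VsetE F = Set.univ

/-- `F` is a `k`-matching: every vertex has at most `k` incident edges. -/
def IsKMatching (k : ℕ) (F : Finset (Sym2 V)) : Prop :=
  SimpleE F ∧ ∀ v : V, degE F v ≤ k

/-- `F` is a `k`-factor: every vertex has exactly `k` incident edges. -/
def IsKFactor (k : ℕ) (F : Finset (Sym2 V)) : Prop :=
  SimpleE F ∧ ∀ v : V, degE F v = k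

/-- `F` is the edge set of a single (simple) cycle. -/
def IsCycleE (F : Finset (Sym2 V)) : Prop :=
  ∃ m : ℕ, 3 ≤ m ∧ ∃ f : ℕ → V,
    (∀ i < m, ∀ j < m, f i = f j → i = j) ∧
    F = (Finset.range m).image (fun i => s(f i, f ((i + 1) % m)))

/-- `F` contains no cycle. -/
def AcyclicE (F : Finset (Sym2 V)) : Prop :=
  ∀ C : Finset (Sym2 V), C ⊆ F → ¬ IsCycleE C

/-- `F` is the edge set of a simple path with endpoints `a` and `b`. -/
def IsPathE (F : Finset (Sym2 V)) (a b : V) : Prop :=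
  ∃ m : ℕ, 1 ≤ m ∧ ∃ f : ℕ → V,
    (∀ i ≤ m, ∀ j ≤ m, f i = f j → i = j) ∧ f 0 = a ∧ f m = b ∧
    F = (Finset.range m).image (fun i => s(f i, f (i + 1)))

/-- `P` is a maximal path of `F`, i.e. `P ∈ 𝒫(F)`. -/
def MaxPathE (F P : Finset (Sym2 V)) : Prop :=
  P ⊆ F ∧ (∃ a b : V, IsPathE P a b) ∧
  ∀ e ∈ F, (∃ v : V, v ∈ e ∧ v ∈ VsetE P) → e ∈ P

/-- `F` is a path cover: a spanning acyclic 2-matching. -/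
def IsPathCoverE (F : Finset (Sym2 V)) : Prop :=
  IsKMatching 2 F ∧ SpanningE F ∧ AcyclicE F

/-- `F` is a tour: the edge set of a Hamiltonian cycle. -/
def IsTourE (F : Finset (Sym2 V)) : Prop :=
  IsCycleE F ∧ SpanningE F

/-- Total length of the edge set `F`. -/
def lenE (ℓ : Sym2 V → ℝ) (F : Finset (Sym2 V)) : ℝ := ∑ e ∈ F, ℓ e

/-- Minimum length of a tour. -/
noncomputable def optE (ℓ : Sym2 V → ℝ) : ℝ :=
  sInf {x | ∃ H : Finset (Sym2 V), IsTourE H ∧ lenE ℓ H = x}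

/-- Maximum length of a tour. -/
noncomputable def worE (ℓ : Sym2 V → ℝ) : ℝ :=
  sSup {x | ∃ H : Finset (Sym2 V), IsTourE H ∧ lenE ℓ H = x}

/-- The set of edges of `F` incident to `v`. -/
def deltaE (F : Finset (Sym2 V)) (v : V) : Finset (Sym2 V) :=
  F.filter (fun e => v ∈ e)

/-- `(S, T)` is a valid pair of spanning 2-matchings. -/
def ValidPairE (S T : Finset (Sym2 V)) : Prop :=
  IsKMatching 2 S ∧ IsKMatching 2 T ∧ SpanningE S ∧ SpanningE T ∧
  AcyclicE T ∧
  (∀ v : V, v ∈ V2E S → v ∈ V2E T → deltaE S v = deltaE T v) ∧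
  (∀ C : Finset (Sym2 V), C ⊆ S → IsCycleE C →
    ∀ P : Finset (Sym2 V), MaxPathE T P → VsetE C ≠ VsetE P)


set_option linter.unusedSectionVars false

/-- The edge `e` has one endpoint inside `X` and one outside. -/
def CrossesE (X : Set V) (e : Sym2 V) : Prop := ∃ u w, e = s(u, w) ∧ u ∈ X ∧ w ∉ X

/-! ### Degrees -/

theorem degE_mono {F H : Finset (Sym2 V)} (h : F ⊆ H) (v : V) : degE F v ≤ degE H v :=
  Finset.card_le_card (Finset.filter_subset_filter _ h)

theorem mem_of_degE_le {F H : Finset (Sym2 V)} (h : F ⊆ H) {v : V} (hd : degE H v ≤ degE F v)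
    {e : Sym2 V} (he : e ∈ H) (hv : v ∈ e) : e ∈ F := by
  have := Finset.eq_of_subset_of_card_le (Finset.filter_subset_filter (fun e => v ∈ e) h) hd
  have h2 : e ∈ H.filter (fun e => v ∈ e) := Finset.mem_filter.2 ⟨he, hv⟩
  rw [← this] at h2
  exact (Finset.mem_filter.1 h2).1

theorem degE_pos_iff {F : Finset (Sym2 V)} {v : V} : 0 < degE F v ↔ v ∈ VsetE F := by
  simp [degE, VsetE, Finset.card_pos, Finset.Nonempty]

theorem spanningE_iff {F : Finset (Sym2 V)} : SpanningE F ↔ ∀ v, 0 < degE F v := by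
  simp only [SpanningE, Set.eq_univ_iff_forall, degE_pos_iff]

theorem two_le_degE {F : Finset (Sym2 V)} {v : V} {e e' : Sym2 V} (he : e ∈ F) (he' : e' ∈ F)
    (hv : v ∈ e) (hv' : v ∈ e') (hne : e ≠ e') : 2 ≤ degE F v :=
  Finset.one_lt_card.2
    ⟨e, Finset.mem_filter.2 ⟨he, hv⟩, e', Finset.mem_filter.2 ⟨he', hv'⟩, hne⟩

theorem degE_insert {F : Finset (Sym2 V)} {e : Sym2 V} (he : e ∉ F) (v : V) :
    degE (insert e F) v = degE F v + if v ∈ e then 1 else 0 := by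
  unfold degE
  rw [Finset.filter_insert]
  split_ifs <;> simp [he]

theorem degE_erase {F : Finset (Sym2 V)} {e : Sym2 V} (he : e ∈ F) (v : V) :
    degE F v = degE (F.erase e) v + if v ∈ e then 1 else 0 := by
  rw [← degE_insert (Finset.notMem_erase e F), Finset.insert_erase he]

/-! ### Cycles -/

/-- A cycle can be traversed by a periodic sequence of vertices. -/
theorem IsCycleE.exists_periodic {C : Finset (Sym2 V)} (hC : IsCycleE C) :
    ∃ m : ℕ, 3 ≤ m ∧ ∃ g : ℕ → V, (∀ i j, g i = g j ↔ i % m = j % m) ∧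
      ∀ e, e ∈ C ↔ ∃ i, e = s(g i, g (i + 1)) := by
  obtain ⟨m, hm, f, hf, rfl⟩ := hC
  have hlt : ∀ i, i % m < m := fun i => Nat.mod_lt _ (by omega)
  refine ⟨m, hm, fun i => f (i % m), fun i j =>
    ⟨fun h => hf _ (hlt i) _ (hlt j) h, fun h => by simp only [h]⟩, fun e => ?_⟩
  simp only [Finset.mem_image, Finset.mem_range]
  constructor
  · rintro ⟨i, hi, rfl⟩
    exact ⟨i, by rw [Nat.mod_eq_of_lt hi]⟩
  · rintro ⟨i, rfl⟩
    exact ⟨i % m, hlt i, by simp⟩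

theorem IsCycleE.two_le_degE {C : Finset (Sym2 V)} (hC : IsCycleE C) {u : V} (hu : u ∈ VsetE C) :
    2 ≤ degE C u := by
  obtain ⟨m, hm, g, hg, hmem⟩ := hC.exists_periodic
  obtain ⟨e, he, hue⟩ := hu
  have key : ∀ i, 2 ≤ degE C (g i) := by
    intro i
    have h1 : g i = g (i + m) := (hg _ _).2 (by simp)
    have h2 : i + m = (i + m - 1) + 1 := by omega
    refine _root_.two_le_degE (e := s(g i, g (i + 1))) (e' := s(g (i + m - 1), g (i + m)))
      ((hmem _).2 ⟨i, rfl⟩) ((hmem _).2 ⟨i + m - 1, by rw [← h2]⟩) (by simp) (by simp [h1]) ?_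
    rw [← h1, Sym2.eq_swap (a := g (i + m - 1))]
    intro h
    rw [Sym2.congr_right, hg] at h
    have h3 : (i + 1) ≡ (i + 1) + (m - 2) [MOD m] := by
      have : i + 1 + (m - 2) = i + m - 1 := by omega
      rw [this]; exact h
    have h4 := (Nat.modEq_iff_dvd' (by omega)).1 h3
    rw [Nat.add_sub_cancel_left] at h4
    have := Nat.le_of_dvd (by omega) h4
    omega
  obtain ⟨i, rfl⟩ := (hmem e).1 he
  rcases Sym2.mem_iff.1 hue with rfl | rfl <;> apply key

/-- A cycle with vertices inside and outside `X` has an edge crossing `X`. -/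
theorem IsCycleE.exists_crossesE {C : Finset (Sym2 V)} (hC : IsCycleE C) {X : Set V} {u w : V}
    (hu : u ∈ VsetE C) (hw : w ∈ VsetE C) (huX : u ∈ X) (hwX : w ∉ X) :
    ∃ e ∈ C, CrossesE X e := by
  obtain ⟨m, hm, g, hg, hmem⟩ := hC.exists_periodic
  have hex : ∀ u ∈ VsetE C, ∃ i, u = g i := by
    rintro u ⟨e, he, hue⟩
    obtain ⟨i, rfl⟩ := (hmem e).1 he
    rcases Sym2.mem_iff.1 hue with rfl | rfl
    exacts [⟨i, rfl⟩, ⟨i + 1, rfl⟩]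
  obtain ⟨i, rfl⟩ := hex u hu
  obtain ⟨j, rfl⟩ := hex w hw
  by_contra! hno
  have hk : ∀ k, g (i + k) ∈ X := by
    intro k
    induction k with
    | zero => exact huX
    | succ k ih =>
      by_contra hn
      exact hno _ ((hmem _).2 ⟨i + k, rfl⟩) ⟨_, _, rfl, ih, hn⟩
  apply hwX
  have h1 : g j = g (i + (j + i * (m - 1))) := (hg _ _).2 (by
    obtain ⟨p, rfl⟩ : ∃ p, m = p + 1 := ⟨m - 1, by omega⟩
    have : i + (j + i * (p + 1 - 1)) = j + (p + 1) * i := by simp; ring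
    rw [this, Nat.add_mul_mod_self_left])
  rw [h1]
  exact hk _

/-- A cycle never crosses a vertex set exactly once. -/
theorem IsCycleE.exists_crossesE_ne {C : Finset (Sym2 V)} (hC : IsCycleE C) {X : Set V}
    {e : Sym2 V} (he : e ∈ C) (heX : CrossesE X e) : ∃ e' ∈ C, e' ≠ e ∧ CrossesE X e' := by
  obtain ⟨m, hm, g, hg, hmem⟩ := hC.exists_periodic
  obtain ⟨i, rfl⟩ := (hmem e).1 he
  by_contra! hno
  have hk : ∀ k, k < m → (g (i + 1) ∈ X ↔ g (i + 1 + k) ∈ X) := by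
    intro k
    induction k with
    | zero => simp
    | succ k ih =>
      intro hkm
      rw [ih (by omega)]
      have hne : s(g (i + 1 + k), g (i + 1 + k + 1)) ≠ s(g i, g (i + 1)) := by
        intro h
        rcases Sym2.eq_iff.1 h with ⟨h1, -⟩ | ⟨h1, h2⟩
        · have h3 : i ≡ i + 1 + k [MOD m] := ((hg _ _).1 h1).symm
          have h4 := (Nat.modEq_iff_dvd' (by omega)).1 h3
          have := Nat.le_of_dvd (by omega) h4
          omega
        · have h3 : i ≡ i + 1 + k + 1 [MOD m] := ((hg _ _).1 h2).symm
          have h4 := (Nat.modEq_iff_dvd' (by omega)).1 h3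
          have h5 := Nat.le_of_dvd (by omega) h4
          have h6 : i + 1 ≡ i + 1 + k [MOD m] := ((hg _ _).1 h1).symm
          have h7 := (Nat.modEq_iff_dvd' (by omega)).1 h6
          have := Nat.le_of_dvd (by omega) h7
          omega
      have hc := hno _ ((hmem _).2 ⟨i + 1 + k, rfl⟩) hne
      constructor
      · intro h
        by_contra hn
        exact hc ⟨_, _, rfl, h, hn⟩
      · intro h
        by_contra hn
        exact hc ⟨_, _, Sym2.eq_swap, h, hn⟩
  have h1 := hk (m - 1) (by omega)
  have h2 : g (i + 1 + (m - 1)) = g i := (hg _ _).2 (by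
    have : i + 1 + (m - 1) = i + m := by omega
    rw [this, Nat.add_mod_right])
  rw [h2] at h1
  obtain ⟨u, w, huw, hu, hw⟩ := heX
  rcases Sym2.eq_iff.1 huw with ⟨rfl, rfl⟩ | ⟨rfl, rfl⟩
  exacts [hw (h1.2 hu), hw (h1.1 hu)]

/-! ### Paths -/

theorem IsPathE.symm {P : Finset (Sym2 V)} {a b : V} (h : IsPathE P a b) : IsPathE P b a := by
  obtain ⟨m, hm, f, hf, rfl, rfl, rfl⟩ := h
  refine ⟨m, hm, fun i => f (m - i), fun i hi j hj hij => ?_, by simp, by simp, ?_⟩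
  · have := hf _ (Nat.sub_le m i) _ (Nat.sub_le m j) hij
    omega
  · ext e
    simp only [Finset.mem_image, Finset.mem_range]
    constructor
    · rintro ⟨i, hi, rfl⟩
      refine ⟨m - (i + 1), by omega, ?_⟩
      rw [Sym2.eq_swap, show m - (m - (i + 1)) = i + 1 by omega,
        show m - (m - (i + 1) + 1) = i by omega]
    · rintro ⟨i, hi, rfl⟩
      refine ⟨m - (i + 1), by omega, ?_⟩
      rw [Sym2.eq_swap, show m - (i + 1) + 1 = m - i by omega]

theorem IsPathE.left_mem {P : Finset (Sym2 V)} {a b : V} (h : IsPathE P a b) : a ∈ VsetE P := by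
  obtain ⟨m, hm, f, hf, rfl, rfl, rfl⟩ := h
  exact ⟨s(f 0, f 1), Finset.mem_image.2 ⟨0, Finset.mem_range.2 hm, rfl⟩, by simp⟩

theorem IsPathE.right_mem {P : Finset (Sym2 V)} {a b : V} (h : IsPathE P a b) : b ∈ VsetE P :=
  h.symm.left_mem

theorem IsPathE.two_le_degE {P : Finset (Sym2 V)} {a b : V} (h : IsPathE P a b) {y : V}
    (hy : y ∈ VsetE P) (hya : y ≠ a) (hyb : y ≠ b) : 2 ≤ degE P y := by
  obtain ⟨m, hm, f, hf, rfl, rfl, rfl⟩ := h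
  have key : ∀ i, i < m → 0 < i →
      2 ≤ degE ((Finset.range m).image (fun i => s(f i, f (i + 1)))) (f i) := by
    intro i hi hi0
    refine _root_.two_le_degE (e := s(f i, f (i + 1))) (e' := s(f (i - 1), f i))
      (Finset.mem_image.2 ⟨i, Finset.mem_range.2 hi, rfl⟩)
      (Finset.mem_image.2 ⟨i - 1, Finset.mem_range.2 (by omega), by
        rw [show i - 1 + 1 = i by omega]⟩) (by simp) (by simp) ?_
    rw [Sym2.eq_swap (a := f (i - 1))]
    intro h
    rw [Sym2.congr_right] at h
    have := hf _ (by omega) _ (by omega) h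
    omega
  obtain ⟨e, he, hye⟩ := hy
  obtain ⟨i, hi, rfl⟩ := Finset.mem_image.1 he
  rw [Finset.mem_range] at hi
  rcases Sym2.mem_iff.1 hye with rfl | rfl
  · exact key i hi (Nat.pos_of_ne_zero (by rintro rfl; exact hya rfl))
  · have : i + 1 ≠ m := by rintro rfl; exact hyb rfl
    exact key (i + 1) (by omega) (by omega)

theorem IsPathE.snoc {P : Finset (Sym2 V)} {a b x : V} (h : IsPathE P a b) (hx : x ∉ VsetE P) :
    IsPathE (insert s(b, x) P) a x := by
  obtain ⟨m, hm, f, hf, rfl, rfl, rfl⟩ := h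
  have hxf : ∀ i ≤ m, f i ≠ x := by
    rintro i hi rfl
    apply hx
    rcases Nat.lt_or_ge i m with h | h
    · exact ⟨s(f i, f (i + 1)), Finset.mem_image.2 ⟨i, Finset.mem_range.2 h, rfl⟩, by simp⟩
    · obtain rfl : i = m := by omega
      exact ⟨s(f (i - 1), f i), Finset.mem_image.2 ⟨i - 1, Finset.mem_range.2 (by omega), by
        rw [show i - 1 + 1 = i by omega]⟩, by simp⟩
  refine ⟨m + 1, by omega, fun i => if i ≤ m then f i else x, fun i hi j hj hij => ?_, by simp,
    by simp, ?_⟩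
  · simp only at hij
    split_ifs at hij with h1 h2 h2
    · exact hf _ h1 _ h2 hij
    · exact absurd hij (hxf _ h1)
    · exact absurd hij.symm (hxf _ h2)
    · omega
  · rw [Finset.range_add_one, Finset.image_insert]
    simp only [le_refl, if_true, Nat.not_succ_le_self, if_false]
    congr 1
    refine Finset.image_congr fun i hi => ?_
    have hi' : i < m := by simpa using hi
    simp [hi'.le, Nat.succ_le_of_lt hi']

/-- In a 2-matching, a vertex of degree one is an endpoint of a maximal path. -/
theorem exists_maxPathE_of_degE_eq_one {T : Finset (Sym2 V)} (hT : IsKMatching 2 T) {v : V}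
    (hv : degE T v = 1) : ∃ P w, IsPathE P v w ∧ MaxPathE T P := by
  classical
  let A := T.powerset.filter (fun F => ∃ b, IsPathE F v b)
  have hA : A.Nonempty := by
    obtain ⟨e, he, hve⟩ := degE_pos_iff.1 (show 0 < degE T v by omega)
    obtain ⟨x, rfl⟩ := hve
    refine ⟨{s(v, x)}, Finset.mem_filter.2 ⟨by simpa using he, x, ?_⟩⟩
    have hvx : v ≠ x := by simpa using hT.1 _ he
    refine ⟨1, le_refl _, fun i => if i = 0 then v else x, fun i hi j hj hij => ?_, by simp,
      by simp, by simp⟩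
    simp only at hij
    split_ifs at hij with h1 h2 h2
    · omega
    · exact absurd hij hvx
    · exact absurd hij.symm hvx
    · omega
  obtain ⟨P, hPA, hmax⟩ := Finset.exists_max_image A Finset.card hA
  obtain ⟨hPT, w, hP⟩ := Finset.mem_filter.1 hPA
  rw [Finset.mem_powerset] at hPT
  refine ⟨P, w, hP, hPT, ⟨v, w, hP⟩, ?_⟩
  have hne : ∀ e ∈ T, ∀ y ∈ e, y ∈ VsetE P → y ≠ w → e ∈ P := by
    intro e he y hye hyP hyw
    by_cases hyv : y = v
    · subst hyv
      have := degE_pos_iff.2 hyP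
      exact mem_of_degE_le hPT (by omega) he hye
    · exact mem_of_degE_le hPT ((hT.2 y).trans (hP.two_le_degE hyP hyv hyw)) he hye
  rintro e he ⟨y, hye, hyP⟩
  by_cases hyw : y = w
  · subst hyw
    obtain ⟨x, rfl⟩ := hye
    have hyx : y ≠ x := by simpa using hT.1 _ he
    by_cases hxP : x ∈ VsetE P
    · exact hne _ he x (by simp) hxP hyx.symm
    · by_contra hn
      have h1 := hmax (insert s(y, x) P) (Finset.mem_filter.2
        ⟨Finset.mem_powerset.2 (Finset.insert_subset he hPT), x, hP.snoc hxP⟩)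
      rw [Finset.card_insert_of_notMem hn] at h1
      omega
  · exact hne e he y hye hyP hyw

theorem MaxPathE.not_crossesE {T P : Finset (Sym2 V)} (hP : MaxPathE T P) {e : Sym2 V}
    (he : e ∈ T) : ¬ CrossesE (VsetE P) e := by
  rintro ⟨u, w, rfl, hu, hw⟩
  exact hw ⟨_, hP.2.2 _ he ⟨u, by simp, hu⟩, by simp⟩

theorem AcyclicE.insert_of_crossesE {T P : Finset (Sym2 V)} (hT : AcyclicE T)
    (hP : MaxPathE T P) {e : Sym2 V} (he : CrossesE (VsetE P) e) : AcyclicE (insert e T) := by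
  intro D hD hDc
  by_cases heD : e ∈ D
  · obtain ⟨e', he', hne, hcr⟩ := hDc.exists_crossesE_ne heD he
    exact hP.not_crossesE ((Finset.mem_insert.1 (hD he')).resolve_left hne) hcr
  · exact hT D ((Finset.subset_insert_iff_of_notMem heD).1 hD) hDc

/-! ### Valid pairs -/

theorem IsKMatching.degE_eq_two {S C : Finset (Sym2 V)} (hS : IsKMatching 2 S) (hCS : C ⊆ S)
    (hC : IsCycleE C) {u : V} (hu : u ∈ VsetE C) : degE S u = 2 :=
  le_antisymm (hS.2 u) ((hC.two_le_degE hu).trans (degE_mono hCS u))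

theorem IsKMatching.mem_cycle {S C : Finset (Sym2 V)} (hS : IsKMatching 2 S) (hCS : C ⊆ S)
    (hC : IsCycleE C) {e : Sym2 V} (he : e ∈ S) {u : V} (hue : u ∈ e) (hu : u ∈ VsetE C) :
    e ∈ C :=
  mem_of_degE_le hCS ((hS.2 u).trans (hC.two_le_degE hu)) he hue

/-- Two cycles of a 2-matching sharing an edge have the same edges. -/
theorem IsKMatching.cycle_subset {S C D : Finset (Sym2 V)} (hS : IsKMatching 2 S) (hCS : C ⊆ S)
    (hC : IsCycleE C) (hDS : D ⊆ S) (hD : IsCycleE D) {e : Sym2 V} (heC : e ∈ C) (heD : e ∈ D) :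
    C ⊆ D := by
  intro e' he'
  have hmem : ∀ w ∈ VsetE C, w ∈ VsetE D := by
    intro w hw
    by_contra hwD
    induction e with | _ a b
    obtain ⟨g, hg, u, x, rfl, hu, hx⟩ := hC.exists_crossesE (X := VsetE D)
      ⟨_, heC, Sym2.mem_mk_left a b⟩ hw ⟨_, heD, Sym2.mem_mk_left a b⟩ hwD
    exact hx ⟨_, hS.mem_cycle hDS hD (hCS hg) (Sym2.mem_mk_left u x) hu, by simp⟩
  induction e' with | _ a b
  exact hS.mem_cycle hDS hD (hCS he') (Sym2.mem_mk_left a b) (hmem a ⟨_, he', by simp⟩)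

theorem ValidPairE.degE_eq_one {S T C : Finset (Sym2 V)} (hST : ValidPairE S T) (hCS : C ⊆ S)
    (hC : IsCycleE C) {e : Sym2 V} (he : e ∈ C) (heT : e ∉ T) {u : V} (hu : u ∈ e) :
    degE T u = 1 := by
  obtain ⟨hS, hT, -, hTs, -, hδ, -⟩ := hST
  have h1 := spanningE_iff.1 hTs u
  have h2 := hT.2 u
  have h3 : degE T u ≠ 2 := by
    intro h
    have h4 : e ∈ deltaE S u := Finset.mem_filter.2 ⟨hCS he, hu⟩
    rw [hδ u (hS.degE_eq_two hCS hC ⟨e, he, hu⟩) h] at h4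
    exact heT (Finset.mem_filter.1 h4).1
  omega

/-- If a maximal path of `T` starts with an edge of a cycle of `S`, it lies in that cycle. -/
theorem ValidPairE.path_subset_cycle {S T C P : Finset (Sym2 V)} (hST : ValidPairE S T)
    (hCS : C ⊆ S) (hC : IsCycleE C) {v w : V} (hP : IsPathE P v w) (hPT : P ⊆ T)
    {e : Sym2 V} (heP : e ∈ P) (hve : v ∈ e) (heC : e ∈ C) : P ⊆ C := by
  obtain ⟨hS, hT, -, -, -, hδ, -⟩ := hST
  have hP' := hP
  obtain ⟨m, hm, f, hf, rfl, rfl, rfl⟩ := hP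
  have hmem : ∀ i < m, s(f i, f (i + 1)) ∈ (Finset.range m).image (fun i => s(f i, f (i + 1))) :=
    fun i hi => Finset.mem_image.2 ⟨i, Finset.mem_range.2 hi, rfl⟩
  have key : ∀ i < m, s(f i, f (i + 1)) ∈ C := by
    intro i
    induction i with
    | zero =>
      intro _
      obtain ⟨i, hi, rfl⟩ := Finset.mem_image.1 heP
      rw [Finset.mem_range] at hi
      rcases Sym2.mem_iff.1 hve with h | h
      · obtain rfl := hf _ (by omega) _ (by omega) h
        exact heC
      · have := hf _ (by omega) _ (by omega) h
        omega
    | succ i ih =>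
      intro hi
      have hiC : f (i + 1) ∈ VsetE C := ⟨_, ih (by omega), by simp⟩
      have hd : 2 ≤ degE T (f (i + 1)) := by
        refine le_trans (hP'.two_le_degE ⟨_, hmem _ hi, by simp⟩ ?_ ?_) (degE_mono hPT _)
        · intro h
          have := hf _ (by omega) _ (by omega) h
          omega
        · intro h
          have := hf _ (by omega) _ (by omega) h
          omega
      have h4 : s(f (i + 1), f (i + 1 + 1)) ∈ deltaE T (f (i + 1)) :=
        Finset.mem_filter.2 ⟨hPT (hmem _ hi), by simp⟩
      rw [← hδ _ (hS.degE_eq_two hCS hC hiC) (le_antisymm (hT.2 _) hd)] at h4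
      exact hS.mem_cycle hCS hC (Finset.mem_filter.1 h4).1 (Sym2.mem_mk_left _ _) hiC
  intro g hg
  obtain ⟨i, hi, rfl⟩ := Finset.mem_image.1 hg
  exact key i (Finset.mem_range.1 hi)

/-- Every cycle `C` of `S` leaves the vertex set of some maximal path of `T` through two distinct
edges. -/
theorem ValidPairE.exists_two_crossesE {S T C : Finset (Sym2 V)} (hST : ValidPairE S T)
    (hCS : C ⊆ S) (hC : IsCycleE C) :
    ∃ P e₁ e₂, MaxPathE T P ∧ e₁ ∈ C ∧ e₂ ∈ C ∧ e₁ ≠ e₂ ∧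
      CrossesE (VsetE P) e₁ ∧ CrossesE (VsetE P) e₂ := by
  have ⟨hS, hT, _, hTs, hTa, hδ, hne⟩ := hST
  obtain ⟨e, heC, heT⟩ : ∃ e ∈ C, e ∉ T := by
    by_contra! h
    exact hTa C h hC
  induction e with | _ v x
  have hv1 : degE T v = 1 := hST.degE_eq_one hCS hC heC heT (by simp)
  have hvC : v ∈ VsetE C := ⟨_, heC, by simp⟩
  obtain ⟨P, w, hP, hPm⟩ := exists_maxPathE_of_degE_eq_one hT hv1
  obtain ⟨z, hzC, hzP⟩ : ∃ z ∈ VsetE C, z ∉ VsetE P := by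
    by_contra! hsub
    have hto : ∀ e ∈ C, v ∈ e → e ∉ T → e = s(v, w) := by
      rintro e he ⟨y, rfl⟩ hyT
      have hy1 : degE T y = 1 := hST.degE_eq_one hCS hC he hyT (by simp)
      have hyP : y ∈ VsetE P := hsub y ⟨_, he, by simp⟩
      have hyv : y ≠ v := by
        rintro rfl
        exact hS.1 _ (hCS he) (by simp)
      by_contra hyw
      have h2 := hP.two_le_degE hyP hyv (by rintro rfl; exact hyw rfl)
      have := degE_mono hPm.1 y
      omega
    obtain ⟨a, ha, b, hb, hab⟩ := Finset.one_lt_card.1 (hC.two_le_degE hvC)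
    rw [Finset.mem_filter] at ha hb
    obtain ⟨g, hgC, hvg, hgT⟩ : ∃ g ∈ C, v ∈ g ∧ g ∈ T := by
      by_contra! h
      exact hab ((hto a ha.1 ha.2 (h a ha.1 ha.2)).trans (hto b hb.1 hb.2 (h b hb.1 hb.2)).symm)
    have hgP : g ∈ P := hPm.2.2 g hgT ⟨v, hvg, hP.left_mem⟩
    have hPC := hST.path_subset_cycle hCS hC hP hPm.1 hgP hvg hgC
    refine hne C hCS hC P hPm (Set.Subset.antisymm hsub ?_)
    rintro y ⟨k, hk, hyk⟩
    exact ⟨k, hPC hk, hyk⟩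
  obtain ⟨e₁, h₁, hc₁⟩ := hC.exists_crossesE hvC hzC hP.left_mem hzP
  obtain ⟨e₂, h₂, h12, hc₂⟩ := hC.exists_crossesE_ne h₁ hc₁
  exact ⟨P, e₁, e₂, hPm, h₁, h₂, h12.symm, hc₁, hc₂⟩

theorem ValidPairE.isPathE_insert {S T C P : Finset (Sym2 V)} (hST : ValidPairE S T)
    (hCS : C ⊆ S) (hC : IsCycleE C) (hP : MaxPathE T P) {e : Sym2 V} (he : e ∈ C)
    (hcr : CrossesE (VsetE P) e) : ∃ a b, IsPathE (insert e P) a b := by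
  have heT : e ∉ T := fun h => hP.not_crossesE h hcr
  obtain ⟨hPT, ⟨v, w, hvw⟩, -⟩ := hP
  obtain ⟨u, x, rfl, hu, hx⟩ := hcr
  have h1 : degE T u = 1 := hST.degE_eq_one hCS hC he heT (by simp)
  by_cases huw : u = w
  · subst huw
    exact ⟨_, _, hvw.snoc hx⟩
  by_cases huv : u = v
  · subst huv
    exact ⟨_, _, hvw.symm.snoc hx⟩
  have h2 := hvw.two_le_degE hu huv huw
  have := degE_mono hPT u
  omega

/-- `(S', T')` has the same union and intersection as `(S, T)`, and likewise for the sets of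
vertices of degree one. -/
structure SameUnionE (S T S' T' : Finset (Sym2 V)) : Prop where
  union : S' ∪ T' = S ∪ T
  inter : S' ∩ T' = S ∩ T
  union_V1E : V1E S' ∪ V1E T' = V1E S ∪ V1E T
  inter_V1E : V1E S' ∩ V1E T' = V1E S ∩ V1E T

section MoveEdge

variable {S T : Finset (Sym2 V)} {e : Sym2 V}

theorem sameUnionE_move (heS : e ∈ S) (heT : e ∉ T) (hS2 : ∀ u ∈ e, degE S u = 2)
    (hT1 : ∀ u ∈ e, degE T u = 1) : SameUnionE S T (S.erase e) (insert e T) := by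
  have hd : ∀ u, (u ∈ e ∧ degE S u = 2 ∧ degE T u = 1 ∧ degE (S.erase e) u = 1 ∧
      degE (insert e T) u = 2) ∨
      (degE (S.erase e) u = degE S u ∧ degE (insert e T) u = degE T u) := by
    intro u
    have h1 := degE_insert heT u
    have h2 := degE_erase heS u
    by_cases hu : u ∈ e
    · have := hS2 u hu
      have := hT1 u hu
      simp only [hu, if_true] at h1 h2
      left
      exact ⟨hu, by omega, by omega, by omega, by omega⟩
    · simp only [hu, if_false] at h1 h2
      right
      exact ⟨by omega, by omega⟩
  refine ⟨?_, ?_, ?_, ?_⟩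
  · ext g
    by_cases hg : g = e
    · subst hg; simp [heS]
    · simp [hg]
  · ext g
    by_cases hg : g = e
    · subst hg; simp [heT]
    · simp [hg]
  · ext u
    simp only [V1E, Set.mem_union, Set.mem_ofPred_eq]
    rcases hd u with ⟨-, h1, h2, h3, h4⟩ | ⟨h1, h2⟩
    · simp [h1, h2, h3, h4]
    · rw [h1, h2]
  · ext u
    simp only [V1E, Set.mem_inter_iff, Set.mem_ofPred_eq]
    rcases hd u with ⟨-, h1, h2, h3, h4⟩ | ⟨h1, h2⟩
    · simp [h1, h2, h3, h4]
    · rw [h1, h2]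

theorem IsKMatching.erase (hS : IsKMatching 2 S) : IsKMatching 2 (S.erase e) :=
  ⟨fun g hg => hS.1 g (Finset.mem_of_mem_erase hg),
    fun u => (degE_mono (Finset.erase_subset e S) u).trans (hS.2 u)⟩

theorem SpanningE.erase (hS : SpanningE S) (heS : e ∈ S) (hS2 : ∀ u ∈ e, degE S u = 2) :
    SpanningE (S.erase e) := by
  rw [spanningE_iff] at hS ⊢
  intro u
  have h2 := degE_erase heS u
  have := hS u
  split_ifs at h2 with hu
  · have := hS2 u hu
    omega
  · omega

theorem IsKMatching.insert (hT : IsKMatching 2 T) (hed : ¬ e.IsDiag) (heT : e ∉ T)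
    (hT1 : ∀ u ∈ e, degE T u = 1) : IsKMatching 2 (insert e T) := by
  refine ⟨fun g hg => ?_, fun u => ?_⟩
  · rcases Finset.mem_insert.1 hg with rfl | hg
    exacts [hed, hT.1 g hg]
  · rw [degE_insert heT]
    split_ifs with hu
    · rw [hT1 u hu]
    · exact hT.2 u

theorem SpanningE.insert (hT : SpanningE T) : SpanningE (insert e T) := by
  rw [spanningE_iff] at hT ⊢
  exact fun u => (hT u).trans_le (degE_mono (Finset.subset_insert e T) u)

theorem ValidPairE.move (hST : ValidPairE S T) (heS : e ∈ S) (heT : e ∉ T)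
    (hS2 : ∀ u ∈ e, degE S u = 2) (hT1 : ∀ u ∈ e, degE T u = 1) (hac : AcyclicE (insert e T)) :
    ValidPairE (S.erase e) (insert e T) := by
  obtain ⟨hS, hT, hSs, hTs, -, hδ, hne⟩ := hST
  have herase : ∀ u ∈ e, degE (S.erase e) u = 1 := by
    intro u hu
    have h1 := degE_erase heS u
    have := hS2 u hu
    simp only [hu, if_true] at h1
    omega
  refine ⟨hS.erase, hT.insert (hS.1 e heS) heT hT1, hSs.erase heS hS2, hTs.insert, hac, ?_, ?_⟩
  · intro u hu1 hu2
    have hue : u ∉ e := by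
      intro hue
      have h1 : degE (S.erase e) u = 2 := hu1
      have := herase u hue
      omega
    have e1 : deltaE (S.erase e) u = deltaE S u := by
      ext g
      simp only [deltaE, Finset.mem_filter, Finset.mem_erase]
      constructor
      · rintro ⟨⟨-, h1⟩, h2⟩; exact ⟨h1, h2⟩
      · rintro ⟨h1, h2⟩
        exact ⟨⟨by rintro rfl; exact hue h2, h1⟩, h2⟩
    have e2 : deltaE (insert e T) u = deltaE T u := by
      rw [deltaE, Finset.filter_insert, if_neg hue, deltaE]
    rw [e1, e2]
    refine hδ u ?_ ?_
    · have h1 : (deltaE (S.erase e) u).card = 2 := hu1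
      rwa [e1] at h1
    · have h1 : (deltaE (insert e T) u).card = 2 := hu2
      rwa [e2] at h1
  · intro C hCS hC P hP hCP
    by_cases heP : e ∈ P
    · induction e with | _ a b
      have ha : a ∈ VsetE C := by
        rw [hCP]
        exact ⟨_, heP, by simp⟩
      have h1 := (hC.two_le_degE ha).trans (degE_mono hCS a)
      have := herase a (by simp)
      omega
    · exact hne C (hCS.trans (Finset.erase_subset e S)) hC P
        ⟨(Finset.subset_insert_iff_of_notMem heP).1 hP.1, hP.2.1,
          fun g hg => hP.2.2 g (Finset.mem_insert_of_mem hg)⟩ hCP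

end MoveEdge

theorem SameUnionE.trans {S T S' T' S'' T'' : Finset (Sym2 V)} (h : SameUnionE S T S' T')
    (h' : SameUnionE S' T' S'' T'') : SameUnionE S T S'' T'' :=
  ⟨h'.union.trans h.union, h'.inter.trans h.inter, h'.union_V1E.trans h.union_V1E,
    h'.inter_V1E.trans h.inter_V1E⟩

theorem ValidPairE.exists_pathCovers {S T : Finset (Sym2 V)} (hST : ValidPairE S T)
    (hcyc : ∃ C : Finset (Sym2 V), C ⊆ S ∧ IsCycleE C) :
    ∃ S1 S2 T1 T2 : Finset (Sym2 V),
      IsPathCoverE S1 ∧ IsPathCoverE S2 ∧ IsPathCoverE T1 ∧ IsPathCoverE T2 ∧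
      SameUnionE S T S1 T1 ∧ SameUnionE S T S2 T2 ∧
      ∃ (e1 e2 : Sym2 V) (P : Finset (Sym2 V)),
        T1 \ T2 = {e1} ∧ T2 \ T1 = {e2} ∧ MaxPathE (T1 ∩ T2) P ∧
        insert e1 P ⊆ T1 ∧ (∃ a b : V, IsPathE (insert e1 P) a b) ∧
        insert e2 P ⊆ T2 ∧ (∃ a b : V, IsPathE (insert e2 P) a b) := by
  induction hn : S.card using Nat.strong_induction_on generalizing S T with
  | _ n ih =>
  obtain ⟨C, hCS, hC⟩ := hcyc
  obtain ⟨P, e₁, e₂, hP, h₁, h₂, h12, hc₁, hc₂⟩ := hST.exists_two_crossesE hCS hC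
  have ⟨hS, hT, hSs, hTs, hTa, _, _⟩ := hST
  have hnT : ∀ {e}, CrossesE (VsetE P) e → e ∉ T := fun hcr h => hP.not_crossesE h hcr
  have hS2 : ∀ e ∈ C, ∀ u ∈ e, degE S u = 2 := fun e he u hu => hS.degE_eq_two hCS hC ⟨e, he, hu⟩
  have hT1 : ∀ e ∈ C, CrossesE (VsetE P) e → ∀ u ∈ e, degE T u = 1 :=
    fun e he hcr u hu => hST.degE_eq_one hCS hC he (hnT hcr) hu
  have hsame : ∀ e ∈ C, CrossesE (VsetE P) e → SameUnionE S T (S.erase e) (insert e T) :=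
    fun e he hcr => sameUnionE_move (hCS he) (hnT hcr) (hS2 e he) (hT1 e he hcr)
  by_cases hac : AcyclicE (S.erase e₁)
  · have hac₂ : AcyclicE (S.erase e₂) := by
      intro D hD hDc
      have hDS := hD.trans (Finset.erase_subset e₂ S)
      have h1D : e₁ ∈ D := by
        by_contra hn1
        exact hac D (Finset.subset_erase.2 ⟨hDS, hn1⟩) hDc
      exact (Finset.subset_erase.1 hD).2 (hS.cycle_subset hCS hC hDS hDc h₁ h1D h₂)
    have hTc : ∀ e ∈ C, CrossesE (VsetE P) e → IsPathCoverE (insert e T) := fun e he hcr =>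
      ⟨hT.insert (hS.1 e (hCS he)) (hnT hcr) (hT1 e he hcr), hTs.insert,
        hTa.insert_of_crossesE hP hcr⟩
    have n1 := hnT hc₁
    have n2 := hnT hc₂
    refine ⟨S.erase e₁, S.erase e₂, insert e₁ T, insert e₂ T,
      ⟨hS.erase, hSs.erase (hCS h₁) (hS2 _ h₁), hac⟩,
      ⟨hS.erase, hSs.erase (hCS h₂) (hS2 _ h₂), hac₂⟩, hTc _ h₁ hc₁, hTc _ h₂ hc₂,
      hsame _ h₁ hc₁, hsame _ h₂ hc₂, e₁, e₂, P, ?_, ?_, ?_,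
      Finset.insert_subset_insert _ hP.1, hST.isPathE_insert hCS hC hP h₁ hc₁,
      Finset.insert_subset_insert _ hP.1, hST.isPathE_insert hCS hC hP h₂ hc₂⟩
    · ext g
      simp only [Finset.mem_sdiff, Finset.mem_insert, Finset.mem_singleton]
      grind
    · ext g
      simp only [Finset.mem_sdiff, Finset.mem_insert, Finset.mem_singleton]
      grind
    · have : insert e₁ T ∩ insert e₂ T = T := by
        ext g
        simp only [Finset.mem_inter, Finset.mem_insert]
        grind
      rwa [this]
  · have hcyc' : ∃ C, C ⊆ S.erase e₁ ∧ IsCycleE C := by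
      unfold AcyclicE at hac
      push Not at hac
      exact hac
    have hlt : (S.erase e₁).card < n := hn ▸ Finset.card_erase_lt_of_mem (hCS h₁)
    obtain ⟨S1, S2, T1, T2, a1, a2, a3, a4, b1, b2, h⟩ := ih _ hlt
      (hST.move (hCS h₁) (hnT hc₁) (hS2 _ h₁) (hT1 _ h₁ hc₁) (hTa.insert_of_crossesE hP hc₁))
      hcyc' rfl
    exact ⟨S1, S2, T1, T2, a1, a2, a3, a4, (hsame _ h₁ hc₁).trans b1, (hsame _ h₁ hc₁).trans b2, h⟩

/-- Lemma 3 of the paper. -/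
theorem stmt1 (S T : Finset (Sym2 V))
    (hST : ValidPairE S T)
    (hcyc : ∃ C : Finset (Sym2 V), C ⊆ S ∧ IsCycleE C) :
    ∃ S1 S2 T1 T2 : Finset (Sym2 V),
      IsPathCoverE S1 ∧ IsPathCoverE S2 ∧ IsPathCoverE T1 ∧ IsPathCoverE T2 ∧
      (S1 ∪ T1 = S ∪ T) ∧ (S1 ∩ T1 = S ∩ T) ∧
      (S2 ∪ T2 = S ∪ T) ∧ (S2 ∩ T2 = S ∩ T) ∧
      (V1E S1 ∪ V1E T1 = V1E S ∪ V1E T) ∧ (V1E S1 ∩ V1E T1 = V1E S ∩ V1E T) ∧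
      (V1E S2 ∪ V1E T2 = V1E S ∪ V1E T) ∧ (V1E S2 ∩ V1E T2 = V1E S ∩ V1E T) ∧
      (∃ (e1 e2 : Sym2 V) (P : Finset (Sym2 V)),
        T1 \ T2 = {e1} ∧ T2 \ T1 = {e2} ∧ MaxPathE (T1 ∩ T2) P ∧
        insert e1 P ⊆ T1 ∧ (∃ a b : V, IsPathE (insert e1 P) a b) ∧
        insert e2 P ⊆ T2 ∧ (∃ a b : V, IsPathE (insert e2 P) a b)) ∧
      (IsKFactor 2 S →
        (V1E S1 ∪ V1E T1 = V1E T ∧ V1E S1 ∩ V1E T1 = ∅ ∧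
         V1E S2 ∪ V1E T2 = V1E T ∧ V1E S2 ∩ V1E T2 = ∅)) := by
  obtain ⟨S1, S2, T1, T2, a1, a2, a3, a4, b1, b2, h⟩ := hST.exists_pathCovers hcyc
  refine ⟨S1, S2, T1, T2, a1, a2, a3, a4, b1.union, b1.inter, b2.union, b2.inter, b1.union_V1E,
    b1.inter_V1E, b2.union_V1E, b2.inter_V1E, h, fun hS => ?_⟩
  have hS1 : V1E S = ∅ := by
    ext v
    simp [V1E, hS.2 v]
  rw [b1.union_V1E, b1.inter_V1E, b2.union_V1E, b2.inter_V1E, hS1]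
  simp
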